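/- Every finite-dimensional simple g_{p₊,p₋}-module is isomorphic to X^α_{r,r'} for exactly one triple (α, r, r') with α ∈ {1,−1}, 1 ≤ r ≤ p₊, 1 ≤ r' ≤ p₋; in particular, g_{p₊,p₋} has exactly 2·p₊·p₋ isomorphism classes of finite-dimensional simple modules. -/

import Mathlib

noncomputable section

/-- Generators of the quantum group `g_{p₊,p₋}`. -/
inductive QGGen : Type
  | Ep | Fp | Em | Fm | K

open FreeAlgebra QGGen

/-- `q = exp(iπ/p)`. -/
def rootOfUnity (p : ℕ) : ℂ := Complex.exp (Real.pi * Complex.I / p)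

/-- The defining relations of the quantum group `g_{p₊,p₋}`. -/
inductive QGRel (pp pm : ℕ) : FreeAlgebra ℂ QGGen → FreeAlgebra ℂ QGGen → Prop
  | EpNil : QGRel pp pm (ι ℂ Ep ^ pp) 0
  | FpNil : QGRel pp pm (ι ℂ Fp ^ pp) 0
  | EmNil : QGRel pp pm (ι ℂ Em ^ pm) 0
  | FmNil : QGRel pp pm (ι ℂ Fm ^ pm) 0
  | KOrd : QGRel pp pm (ι ℂ K ^ (2 * pp * pm)) 1
  | KEp : QGRel pp pm (ι ℂ K * ι ℂ Ep)
      (algebraMap ℂ (FreeAlgebra ℂ QGGen) ((rootOfUnity pp) ^ 2) * (ι ℂ Ep * ι ℂ K))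
  | KFp : QGRel pp pm (ι ℂ K * ι ℂ Fp)
      (algebraMap ℂ (FreeAlgebra ℂ QGGen) (((rootOfUnity pp) ^ 2)⁻¹) * (ι ℂ Fp * ι ℂ K))
  | KEm : QGRel pp pm (ι ℂ K * ι ℂ Em)
      (algebraMap ℂ (FreeAlgebra ℂ QGGen) ((rootOfUnity pm) ^ 2) * (ι ℂ Em * ι ℂ K))
  | KFm : QGRel pp pm (ι ℂ K * ι ℂ Fm)
      (algebraMap ℂ (FreeAlgebra ℂ QGGen) (((rootOfUnity pm) ^ 2)⁻¹) * (ι ℂ Fm * ι ℂ K))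
  | EpEm : QGRel pp pm (ι ℂ Ep * ι ℂ Em) (ι ℂ Em * ι ℂ Ep)
  | FpFm : QGRel pp pm (ι ℂ Fp * ι ℂ Fm) (ι ℂ Fm * ι ℂ Fp)
  | EpFm : QGRel pp pm (ι ℂ Ep * ι ℂ Fm) (ι ℂ Fm * ι ℂ Ep)
  | EmFp : QGRel pp pm (ι ℂ Em * ι ℂ Fp) (ι ℂ Fp * ι ℂ Em)
  | EpFp : QGRel pp pm (ι ℂ Ep * ι ℂ Fp - ι ℂ Fp * ι ℂ Ep)
      (algebraMap ℂ (FreeAlgebra ℂ QGGen)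
          (((rootOfUnity pp) ^ pm - ((rootOfUnity pp) ^ pm)⁻¹)⁻¹) *
        (ι ℂ K ^ pm - ι ℂ K ^ (2 * pp * pm - pm)))
  | EmFm : QGRel pp pm (ι ℂ Em * ι ℂ Fm - ι ℂ Fm * ι ℂ Em)
      (algebraMap ℂ (FreeAlgebra ℂ QGGen)
          (((rootOfUnity pm) ^ pp - ((rootOfUnity pm) ^ pp)⁻¹)⁻¹) *
        (ι ℂ K ^ pp - ι ℂ K ^ (2 * pp * pm - pp)))

/-- The quantum group `g_{p₊,p₋}`. -/
abbrev QG (pp pm : ℕ) : Type := RingQuot (QGRel pp pm)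

/-- The image of a generator in `g_{p₊,p₋}`. -/
def gen (pp pm : ℕ) (x : QGGen) : QG pp pm :=
  RingQuot.mkAlgHom ℂ (QGRel pp pm) (ι ℂ x)

/-- The quantum integer `[m]₊`. -/
def qintP (pp pm : ℕ) (m : ℤ) : ℂ :=
  (rootOfUnity pp ^ ((pm : ℤ) * m) - rootOfUnity pp ^ (-((pm : ℤ) * m))) /
    (rootOfUnity pp ^ (pm : ℤ) - rootOfUnity pp ^ (-(pm : ℤ)))

/-- The quantum integer `[m]₋`. -/
def qintM (pp pm : ℕ) (m : ℤ) : ℂ :=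
  (rootOfUnity pm ^ ((pp : ℤ) * m) - rootOfUnity pm ^ (-((pp : ℤ) * m))) /
    (rootOfUnity pm ^ (pp : ℤ) - rootOfUnity pm ^ (-(pp : ℤ)))

/-- The underlying vector space of the module `X^α_{r,r'}`, with basis `a_{n,n'}`. -/
abbrev Vrep (r r' : ℕ) : Type := Fin r × Fin r' → ℂ

/-- The action of `K` on `X^α_{r,r'}`. -/
def Kop (pp pm : ℕ) (α : ℂ) (r r' : ℕ) : Vrep r r' →ₗ[ℂ] Vrep r r' where
  toFun v := fun nn =>
    α * rootOfUnity pp ^ ((r : ℤ) - 1 - 2 * (nn.1 : ℕ)) *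
      rootOfUnity pm ^ ((r' : ℤ) - 1 - 2 * (nn.2 : ℕ)) * v nn
  map_add' x y := by funext nn; simp [mul_add]
  map_smul' c x := by funext nn; simp [Pi.smul_apply, smul_eq_mul]; ring

/-- The action of `E₊` on `X^α_{r,r'}` : `E₊·a_{n,n'} = α^{p₋}(−1)^{r'−1}[n]₊[r−n]₊ a_{n−1,n'}`. -/
def EopP (pp pm : ℕ) (α : ℂ) (r r' : ℕ) : Vrep r r' →ₗ[ℂ] Vrep r r' where
  toFun v := fun nn =>
    α ^ pm * (-1 : ℂ) ^ (r' - 1) *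
      (if h : (nn.1 : ℕ) + 1 < r then
        qintP pp pm ((nn.1 : ℕ) + 1) * qintP pp pm ((r : ℤ) - ((nn.1 : ℕ) + 1)) *
          v (⟨(nn.1 : ℕ) + 1, h⟩, nn.2)
      else 0)
  map_add' x y := by
    funext nn
    simp only [Pi.add_apply]
    split_ifs with h <;> ring
  map_smul' c x := by
    funext nn
    simp only [Pi.smul_apply, smul_eq_mul, RingHom.id_apply]
    split_ifs with h <;> ring

/-- The action of `E₋` on `X^α_{r,r'}` : `E₋·a_{n,n'} = α^{p₊}(−1)^{r−1}[n']₋[r'−n']₋ a_{n,n'−1}`. -/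
def EopM (pp pm : ℕ) (α : ℂ) (r r' : ℕ) : Vrep r r' →ₗ[ℂ] Vrep r r' where
  toFun v := fun nn =>
    α ^ pp * (-1 : ℂ) ^ (r - 1) *
      (if h : (nn.2 : ℕ) + 1 < r' then
        qintM pp pm ((nn.2 : ℕ) + 1) * qintM pp pm ((r' : ℤ) - ((nn.2 : ℕ) + 1)) *
          v (nn.1, ⟨(nn.2 : ℕ) + 1, h⟩)
      else 0)
  map_add' x y := by
    funext nn
    simp only [Pi.add_apply]
    split_ifs with h <;> ring
  map_smul' c x := by
    funext nn
    simp only [Pi.smul_apply, smul_eq_mul, RingHom.id_apply]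
    split_ifs with h <;> ring

/-- The action of `F₊` on `X^α_{r,r'}` : `F₊·a_{n,n'} = a_{n+1,n'}`. -/
def FopP (r r' : ℕ) : Vrep r r' →ₗ[ℂ] Vrep r r' where
  toFun v := fun nn =>
    if 0 < (nn.1 : ℕ) then
      v (⟨(nn.1 : ℕ) - 1, Nat.lt_of_le_of_lt (Nat.sub_le _ 1) nn.1.isLt⟩, nn.2)
    else 0
  map_add' x y := by
    funext nn
    simp only [Pi.add_apply]
    split_ifs with h <;> ring
  map_smul' c x := by
    funext nn
    simp only [Pi.smul_apply, smul_eq_mul, RingHom.id_apply]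
    split_ifs with h <;> ring

/-- The action of `F₋` on `X^α_{r,r'}` : `F₋·a_{n,n'} = a_{n,n'+1}`. -/
def FopM (r r' : ℕ) : Vrep r r' →ₗ[ℂ] Vrep r r' where
  toFun v := fun nn =>
    if 0 < (nn.2 : ℕ) then
      v (nn.1, ⟨(nn.2 : ℕ) - 1, Nat.lt_of_le_of_lt (Nat.sub_le _ 1) nn.2.isLt⟩)
    else 0
  map_add' x y := by
    funext nn
    simp only [Pi.add_apply]
    split_ifs with h <;> ring
  map_smul' c x := by
    funext nn
    simp only [Pi.smul_apply, smul_eq_mul, RingHom.id_apply]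
    split_ifs with h <;> ring

/-- `ρ` is the standard representation of `g_{p₊,p₋}` on `X^α_{r,r'}`. -/
def IsStdRep (pp pm : ℕ) (α : ℂ) (r r' : ℕ)
    (ρ : QG pp pm →ₐ[ℂ] Module.End ℂ (Vrep r r')) : Prop :=
  ρ (gen pp pm K) = Kop pp pm α r r' ∧
  ρ (gen pp pm Ep) = EopP pp pm α r r' ∧
  ρ (gen pp pm Em) = EopM pp pm α r r' ∧
  ρ (gen pp pm Fp) = FopP r r' ∧
  ρ (gen pp pm Fm) = FopM r r'

section RootsOfUnity

lemma rootOfUnity_isPrimitiveRoot {p : ℕ} (hp : 2 ≤ p) :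
    IsPrimitiveRoot (rootOfUnity p) (2 * p) := by
  have h := Complex.isPrimitiveRoot_exp (2 * p) (by omega)
  have hp0 : (p : ℂ) ≠ 0 := by exact_mod_cast (by omega : p ≠ 0)
  convert h using 1
  unfold rootOfUnity
  congr 1
  push_cast
  field_simp

lemma rootOfUnity_ne_zero (p : ℕ) : rootOfUnity p ≠ 0 := Complex.exp_ne_zero _

lemma rootOfUnity_pow_self {p : ℕ} (hp : 2 ≤ p) : rootOfUnity p ^ p = -1 := by
  have h := (rootOfUnity_isPrimitiveRoot hp).pow (by omega) (mul_comm 2 p)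
  exact h.eq_neg_one_of_two_right

lemma isPrimitiveRoot_rootOfUnity_sq {p : ℕ} (hp : 2 ≤ p) :
    IsPrimitiveRoot (rootOfUnity p ^ 2) p :=
  (rootOfUnity_isPrimitiveRoot hp).pow (by omega) rfl

lemma isPrimitiveRoot_rootOfUnity_pow_sq {p p' : ℕ} (hp : 2 ≤ p) (hco : p.Coprime p') :
    IsPrimitiveRoot ((rootOfUnity p ^ p') ^ 2) p := by
  have h := (isPrimitiveRoot_rootOfUnity_sq hp).pow_of_coprime p' hco.symm
  rwa [← pow_mul, mul_comm, pow_mul] at h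

lemma pow_sub_inv_ne_zero {Q : ℂ} {p : ℕ} (hQ : IsPrimitiveRoot (Q ^ 2) p) (hQ0 : Q ≠ 0) {n : ℕ}
    (hn : 0 < n) (hnp : n < p) : Q ^ n - (Q ^ n)⁻¹ ≠ 0 := by
  intro h
  have h1 : (Q ^ 2) ^ n = 1 := by
    have h2 : Q ^ n ≠ 0 := pow_ne_zero _ hQ0
    field_simp at h
    rw [← pow_mul, mul_comm, pow_mul]
    linear_combination h
  exact absurd (Nat.le_of_dvd hn (hQ.dvd_of_pow_eq_one n h1)) (by omega)

lemma qintP_eq (p p' : ℕ) (m : ℤ) :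
    qintP p p' m = ((rootOfUnity p ^ p') ^ m - ((rootOfUnity p ^ p') ^ m)⁻¹) /
      (rootOfUnity p ^ p' - (rootOfUnity p ^ p')⁻¹) := by
  simp only [qintP, zpow_neg, zpow_mul, zpow_natCast]

lemma qintP_ne_zero {p p' : ℕ} (hp : 2 ≤ p) (hco : p.Coprime p') {n : ℕ}
    (hn : 0 < n) (hnp : n < p) : qintP p p' n ≠ 0 := by
  have hQ := isPrimitiveRoot_rootOfUnity_pow_sq hp hco
  have hQ0 : rootOfUnity p ^ p' ≠ 0 := pow_ne_zero _ (rootOfUnity_ne_zero p)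
  rw [qintP_eq, zpow_natCast]
  refine div_ne_zero (pow_sub_inv_ne_zero hQ hQ0 hn hnp) ?_
  simpa using pow_sub_inv_ne_zero hQ hQ0 one_pos (by omega)

lemma qintP_zero (p p' : ℕ) : qintP p p' 0 = 0 := by simp [qintP_eq]

lemma qintP_mul_add {p p' : ℕ} (hp : 2 ≤ p) (hco : p.Coprime p') (n r : ℤ) :
    qintP p p' n * qintP p p' (r - n) + qintP p p' (r - 1 - 2 * n) =
      qintP p p' (n + 1) * qintP p p' (r - (n + 1)) := by
  have hQ0 : rootOfUnity p ^ p' ≠ 0 := pow_ne_zero _ (rootOfUnity_ne_zero p)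
  have hd : rootOfUnity p ^ p' - (rootOfUnity p ^ p')⁻¹ ≠ 0 := by
    simpa using pow_sub_inv_ne_zero (isPrimitiveRoot_rootOfUnity_pow_sq hp hco) hQ0 one_pos
      (by omega)
  simp only [qintP_eq]
  generalize rootOfUnity p ^ p' = Q at hQ0 hd
  have e1 : Q ^ (r - 1 - 2 * n) = Q ^ r * Q⁻¹ * ((Q ^ n)⁻¹ * (Q ^ n)⁻¹) := by
    rw [zpow_sub₀ hQ0, zpow_sub₀ hQ0, two_mul, zpow_add₀ hQ0, zpow_one]
    field_simp
  rw [e1, zpow_sub₀ hQ0, zpow_sub₀ hQ0, zpow_add₀ hQ0, zpow_one]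
  have hn : Q ^ n ≠ 0 := zpow_ne_zero _ hQ0
  have hr : Q ^ r ≠ 0 := zpow_ne_zero _ hQ0
  generalize Q ^ n = u at hn
  generalize Q ^ r = t at hr
  rw [div_mul_div_comm, div_mul_div_comm, div_add_div _ _ (mul_ne_zero hd hd) hd,
    div_eq_div_iff (mul_ne_zero (mul_ne_zero hd hd) hd) (mul_ne_zero hd hd)]
  field_simp
  ring

/-- Every root of unity of order dividing `2 * p * p'` is the highest weight of some
`X^α_{i+1,j+1}`. -/
lemma exists_weight {p p' : ℕ} (hp : 2 ≤ p) (hp' : 2 ≤ p') (hco : p.Coprime p') {l : ℂ}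
    (hl : l ^ (2 * p * p') = 1) :
    ∃ i < p, ∃ j < p', ∃ α : ℂ, (α = 1 ∨ α = -1) ∧
      l = α * rootOfUnity p ^ i * rootOfUnity p' ^ j := by
  have : NeZero p := ⟨by omega⟩
  have : NeZero p' := ⟨by omega⟩
  obtain ⟨i, hi, hi'⟩ := (isPrimitiveRoot_rootOfUnity_pow_sq hp hco).eq_pow_of_pow_eq_one
    (ξ := l ^ (2 * p')) (by rw [← pow_mul, ← hl]; ring)
  obtain ⟨j, hj, hj'⟩ := (isPrimitiveRoot_rootOfUnity_pow_sq hp' hco.symm).eq_pow_of_pow_eq_one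
    (ξ := l ^ (2 * p)) (by rw [← pow_mul, ← hl])
  have h0 := rootOfUnity_ne_zero p
  have h0' := rootOfUnity_ne_zero p'
  have h1 := (rootOfUnity_isPrimitiveRoot hp).pow_eq_one
  have h1' := (rootOfUnity_isPrimitiveRoot hp').pow_eq_one
  generalize rootOfUnity p = q at *
  generalize rootOfUnity p' = q' at *
  have hne : q ^ i * q' ^ j ≠ 0 := mul_ne_zero (pow_ne_zero _ h0) (pow_ne_zero _ h0')
  have key : ((l / (q ^ i * q' ^ j)) ^ 2) = 1 := by
    rw [← orderOf_eq_one_iff, ← Nat.dvd_one, ← hco]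
    refine Nat.dvd_gcd (orderOf_dvd_of_pow_eq_one ?_) (orderOf_dvd_of_pow_eq_one ?_)
    · rw [← pow_mul, div_pow, ← hj', div_eq_one_iff_eq (pow_ne_zero _ hne), mul_pow,
        pow_right_comm q, h1, one_pow, one_mul, ← pow_mul, ← pow_mul, ← pow_mul]
      congr 1; ring
    · rw [← pow_mul, div_pow, ← hi', div_eq_one_iff_eq (pow_ne_zero _ hne), mul_pow,
        pow_right_comm q', h1', one_pow, mul_one, ← pow_mul, ← pow_mul, ← pow_mul]
      congr 1; ring
  refine ⟨i, hi, j, hj, l / (q ^ i * q' ^ j), mul_self_eq_one_iff.mp (by rw [← sq, key]), ?_⟩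
  field_simp

/-- The weights `q₊^{-2n} q₋^{-2n'}` with `n < p₊`, `n' < p₋` are pairwise distinct. -/
lemma weight_injective {p p' : ℕ} (hp : 2 ≤ p) (hp' : 2 ≤ p') (hco : p.Coprime p')
    {m n m' n' : ℕ} (hm : m < p) (hn : n < p) (hm' : m' < p') (hn' : n' < p')
    (h : ((rootOfUnity p ^ 2)⁻¹) ^ m * ((rootOfUnity p' ^ 2)⁻¹) ^ m' =
      ((rootOfUnity p ^ 2)⁻¹) ^ n * ((rootOfUnity p' ^ 2)⁻¹) ^ n') : m = n ∧ m' = n' := by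
  have h1 := (isPrimitiveRoot_rootOfUnity_sq hp).inv
  have h1' := (isPrimitiveRoot_rootOfUnity_sq hp').inv
  generalize (rootOfUnity p ^ 2)⁻¹ = q at *
  generalize (rootOfUnity p' ^ 2)⁻¹ = q' at *
  constructor
  · refine (h1.pow_of_coprime p' hco.symm).pow_inj hm hn ?_
    have := congrArg (· ^ p') h
    simpa [mul_pow, ← pow_mul, mul_comm _ p', pow_mul q' p', h1'.pow_eq_one] using this
  · refine (h1'.pow_of_coprime p hco).pow_inj hm' hn' ?_
    have := congrArg (· ^ p) h
    simpa [mul_pow, ← pow_mul, mul_comm _ p, pow_mul q p, h1.pow_eq_one] using this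

end RootsOfUnity

section Operators

variable {M : Type*} [AddCommGroup M] [Module ℂ M]

/-- Operators on `M` satisfying the defining relations of `g_{p,p'}`. -/
structure IsQGAction (p p' : ℕ) (K E F E' F' : Module.End ℂ M) : Prop where
  E_pow : E ^ p = 0
  F_pow : F ^ p = 0
  E'_pow : E' ^ p' = 0
  F'_pow : F' ^ p' = 0
  K_pow : K ^ (2 * p * p') = 1
  K_E : K * E = (rootOfUnity p ^ 2) • (E * K)
  K_F : K * F = (rootOfUnity p ^ 2)⁻¹ • (F * K)
  K_E' : K * E' = (rootOfUnity p' ^ 2) • (E' * K)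
  K_F' : K * F' = (rootOfUnity p' ^ 2)⁻¹ • (F' * K)
  E_E' : Commute E E'
  F_F' : Commute F F'
  E_F' : Commute E F'
  E'_F : Commute E' F
  E_F : E * F - F * E = (rootOfUnity p ^ p' - (rootOfUnity p ^ p')⁻¹)⁻¹ •
    (K ^ p' - K ^ (2 * p * p' - p'))
  E'_F' : E' * F' - F' * E' = (rootOfUnity p' ^ p - (rootOfUnity p' ^ p)⁻¹)⁻¹ •
    (K ^ p - K ^ (2 * p * p' - p))

/-- A nonzero vector of weight `l` killed by `E` and `E'`. -/
structure IsHighestWeight (K E E' : Module.End ℂ M) (l : ℂ) (v : M) : Prop where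
  ne_zero : v ≠ 0
  K_apply : K v = l • v
  E_apply : E v = 0
  E'_apply : E' v = 0

namespace IsHighestWeight

variable {K E E' : Module.End ℂ M} {l l' : ℂ} {v : M}

lemma symm (h : IsHighestWeight K E E' l v) : IsHighestWeight K E' E l v :=
  ⟨h.ne_zero, h.K_apply, h.E'_apply, h.E_apply⟩

lemma congr_weight (h : IsHighestWeight K E E' l v) (hl : l = l') :
    IsHighestWeight K E E' l' v := hl ▸ h

end IsHighestWeight

/-- The operators in `S` have no common invariant subspace other than `⊥` and `⊤`. -/
def IsIrreducibleUnder (S : Set (Module.End ℂ M)) : Prop :=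
  ∀ U : Submodule ℂ M, (∀ A ∈ S, U ≤ U.comap A) → U = ⊥ ∨ U = ⊤

lemma IsIrreducibleUnder.symm {K E F E' F' : Module.End ℂ M}
    (h : IsIrreducibleUnder {K, E, F, E', F'}) : IsIrreducibleUnder {K, E', F', E, F} := by
  convert h using 1
  ext
  simp only [Set.mem_insert_iff, Set.mem_singleton_iff]
  tauto

lemma apply_pow_of_mul_eq_smul {K F : Module.End ℂ M} {c l : ℂ} (h : K * F = c • (F * K)) {w : M}
    (hw : K w = l • w) (n : ℕ) : K ((F ^ n) w) = (l * c ^ n) • (F ^ n) w := by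
  induction n with
  | zero => simpa using hw
  | succ n ih =>
    have := LinearMap.congr_fun h ((F ^ n) w)
    simp only [Module.End.mul_apply, LinearMap.smul_apply] at this
    rw [pow_succ', Module.End.mul_apply, this, ih, map_smul, smul_smul]
    congr 1; ring

lemma pow_apply_of_apply_eq_smul {K : Module.End ℂ M} {l : ℂ} {w : M}
    (hw : K w = l • w) (n : ℕ) : (K ^ n) w = l ^ n • w := by
  induction n with
  | zero => simp
  | succ n ih =>
    rw [pow_succ, Module.End.mul_apply, hw, map_smul, ih, smul_smul, pow_succ']

lemma Commute.apply_apply {A B : Module.End ℂ M} (h : Commute A B) (x : M) : A (B x) = B (A x) :=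
  LinearMap.congr_fun h.eq x

/-- A nonzero vector can be raised until it is killed by a nilpotent operator. -/
lemma exists_pow_apply_ne_zero {E : Module.End ℂ M} {p : ℕ} (hE : E ^ p = 0) {v : M}
    (hv : v ≠ 0) : ∃ n, (E ^ n) v ≠ 0 ∧ E ((E ^ n) v) = 0 := by
  classical
  have hex : ∃ n, (E ^ n) v = 0 := ⟨p, by simp [hE]⟩
  have hpos : Nat.find hex ≠ 0 := fun h => hv (by simpa [h] using Nat.find_spec hex)
  refine ⟨Nat.find hex - 1, Nat.find_min hex (by omega), ?_⟩
  rw [← Module.End.mul_apply, ← pow_succ', Nat.sub_add_cancel (by omega)]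
  exact Nat.find_spec hex

namespace IsQGAction

variable {p p' : ℕ} {K E F E' F' : Module.End ℂ M}

lemma symm (h : IsQGAction p p' K E F E' F') : IsQGAction p' p K E' F' E F where
  E_pow := h.E'_pow
  F_pow := h.F'_pow
  E'_pow := h.E_pow
  F'_pow := h.F_pow
  K_pow := by rw [mul_right_comm]; exact h.K_pow
  K_E := h.K_E'
  K_F := h.K_F'
  K_E' := h.K_E
  K_F' := h.K_F
  E_E' := h.E_E'.symm
  F_F' := h.F_F'.symm
  E_F' := h.E'_F
  E'_F := h.E_F'
  E_F := by rw [mul_right_comm]; exact h.E'_F'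
  E'_F' := by rw [mul_right_comm]; exact h.E_F

lemma exists_isHighestWeight [FiniteDimensional ℂ M] [Nontrivial M]
    (h : IsQGAction p p' K E F E' F') : ∃ l v, IsHighestWeight K E E' l v := by
  obtain ⟨l, hl⟩ := Module.End.exists_eigenvalue K
  obtain ⟨v, hv⟩ := hl.exists_hasEigenvector
  obtain ⟨n, hn, hn'⟩ := exists_pow_apply_ne_zero h.E_pow hv.2
  obtain ⟨m, hm, hm'⟩ := exists_pow_apply_ne_zero h.E'_pow hn
  refine ⟨_, _, hm, apply_pow_of_mul_eq_smul h.K_E'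
    (apply_pow_of_mul_eq_smul h.K_E hv.apply_eq_smul n) m, ?_, hm'⟩
  rw [(h.E_E'.pow_right m).apply_apply, hn', map_zero]

lemma weight_pow {l : ℂ} {v : M} (h : IsQGAction p p' K E F E' F')
    (hv : IsHighestWeight K E E' l v) : l ^ (2 * p * p') = 1 := by
  have := pow_apply_of_apply_eq_smul hv.K_apply (2 * p * p')
  rw [h.K_pow, Module.End.one_apply] at this
  by_contra hne
  have h2 : (l ^ (2 * p * p') - 1) • v = 0 := by rw [sub_smul, one_smul, ← this, sub_self]
  exact (smul_eq_zero.mp h2).elim (fun h => hne (sub_eq_zero.mp h)) hv.ne_zero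

lemma K_pow_pow_apply {l : ℂ} {v : M} (h : IsQGAction p p' K E F E' F')
    (hv : IsHighestWeight K E E' l v) (n n' : ℕ) :
    K ((F ^ n) ((F' ^ n') v)) =
      (l * ((rootOfUnity p' ^ 2)⁻¹) ^ n' * ((rootOfUnity p ^ 2)⁻¹) ^ n) •
        (F ^ n) ((F' ^ n') v) :=
  apply_pow_of_mul_eq_smul h.K_F (apply_pow_of_mul_eq_smul h.K_F' hv.K_apply n') n

lemma E_pow_pow_apply (h : IsQGAction p p' K E F E' F') (hp : 2 ≤ p) (hp' : 2 ≤ p')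
    (hco : p.Coprime p') {α : ℂ} (hα : α = 1 ∨ α = -1) {i j : ℕ} {v : M}
    (hv : IsHighestWeight K E E' (α * rootOfUnity p ^ i * rootOfUnity p' ^ j) v) (n n' : ℕ) :
    E ((F ^ n) ((F' ^ n') v)) =
      (α ^ p' * (-1) ^ j * (qintP p p' n * qintP p p' (i + 1 - n : ℤ))) •
        (F ^ (n - 1)) ((F' ^ n') v) := by
  induction n with
  | zero =>
    simp [(h.E_F'.pow_right n').apply_apply, hv.E_apply, qintP_zero]
  | succ n ih =>
    set w := (F' ^ n') v with hw
    have hK := h.K_pow_pow_apply hv n n'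
    rw [← hw] at hK
    set κ := α * rootOfUnity p ^ i * rootOfUnity p' ^ j * ((rootOfUnity p' ^ 2)⁻¹) ^ n' *
      ((rootOfUnity p ^ 2)⁻¹) ^ n with hκ
    set Q := rootOfUnity p ^ p' with hQ
    have hQ0 : Q ≠ 0 := pow_ne_zero _ (rootOfUnity_ne_zero p)
    have hκ1 : κ ^ p' = α ^ p' * (-1) ^ j * Q ^ (i + 1 - 1 - 2 * n : ℤ) := by
      have h1 : ((rootOfUnity p' ^ 2)⁻¹) ^ p' = 1 :=
        (isPrimitiveRoot_rootOfUnity_sq hp').inv.pow_eq_one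
      rw [add_sub_cancel_right, zpow_sub₀ hQ0, zpow_natCast, zpow_mul, zpow_natCast, hκ, hQ,
        mul_pow, mul_pow, mul_pow, mul_pow, pow_right_comm _ n', h1, one_pow, pow_right_comm _ j,
        rootOfUnity_pow_self hp', inv_pow, inv_pow]
      norm_cast
      ring
    have hκ0 : κ ^ (2 * p * p') = 1 := by
      have h2 : (α ^ p' * (-1) ^ j) ^ 2 = 1 := by
        rw [mul_pow, pow_right_comm, pow_right_comm (-1 : ℂ)]
        rcases hα with rfl | rfl <;> simp
      rw [mul_comm, pow_mul, hκ1, mul_pow, pow_mul, h2, one_pow, one_mul, ← zpow_natCast,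
        zpow_comm, zpow_natCast, hQ, pow_right_comm,
        (rootOfUnity_isPrimitiveRoot hp).pow_eq_one, one_pow, one_zpow]
    have hκ2 : κ ^ (2 * p * p' - p') =
        α ^ p' * (-1) ^ j * (Q ^ (i + 1 - 1 - 2 * n : ℤ))⁻¹ := by
      have h2 : (α ^ p' * (-1) ^ j)⁻¹ = α ^ p' * (-1) ^ j := by
        rw [mul_inv, ← inv_pow, ← inv_pow]
        rcases hα with rfl | rfl <;> norm_num
      have hle : p' ≤ 2 * p * p' := Nat.le_mul_of_pos_left _ (by omega)
      have h3 : κ ^ (2 * p * p' - p') * κ ^ p' = 1 := by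
        rw [← pow_add, Nat.sub_add_cancel hle, hκ0]
      rw [eq_inv_of_mul_eq_one_left h3, hκ1, mul_inv, h2]
    have hEF := LinearMap.congr_fun h.E_F ((F ^ n) w)
    simp only [LinearMap.sub_apply, Module.End.mul_apply, LinearMap.smul_apply,
      pow_apply_of_apply_eq_smul hK, hκ1, hκ2] at hEF
    have hF : F (E ((F ^ n) w)) =
        (α ^ p' * (-1) ^ j * (qintP p p' n * qintP p p' (i + 1 - n : ℤ))) • (F ^ n) w := by
      rw [ih, map_smul]
      rcases Nat.eq_zero_or_pos n with rfl | hn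
      · simp [qintP_zero]
      · rw [← Module.End.mul_apply, ← pow_succ', Nat.sub_add_cancel hn]
    rw [pow_succ', Module.End.mul_apply, eq_add_of_sub_eq hEF, hF, ← sub_smul, smul_smul,
      ← add_smul, Nat.add_sub_cancel]
    congr 1
    have := qintP_mul_add hp hco n (i + 1)
    push_cast
    rw [← this, qintP_eq p p' (i + 1 - 1 - 2 * n)]
    ring

lemma span_eq_top (h : IsQGAction p p' K E F E' F') (hp : 2 ≤ p) (hp' : 2 ≤ p')
    (hco : p.Coprime p') (hs : IsIrreducibleUnder {K, E, F, E', F'}) {l : ℂ} {v : M}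
    (hv : IsHighestWeight K E E' l v) :
    Submodule.span ℂ (Set.range fun n : ℕ × ℕ => (F ^ n.1) ((F' ^ n.2) v)) = ⊤ := by
  obtain ⟨i, -, j, -, α, hα, rfl⟩ := exists_weight hp hp' hco (h.weight_pow hv)
  set S := Submodule.span ℂ (Set.range fun n : ℕ × ℕ => (F ^ n.1) ((F' ^ n.2) v))
  have hmem (n n' : ℕ) : (F ^ n) ((F' ^ n') v) ∈ S := Submodule.subset_span ⟨(n, n'), rfl⟩
  refine (hs S ?_).resolve_left fun hbot => hv.ne_zero ?_
  · simp only [Set.mem_insert_iff, Set.mem_singleton_iff, forall_eq_or_imp, forall_eq]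
    refine ⟨?_, ?_, ?_, ?_, ?_⟩ <;> refine Submodule.span_le.mpr ?_ <;> rintro _ ⟨⟨n, n'⟩, rfl⟩ <;>
      simp only [SetLike.mem_coe, Submodule.mem_comap]
    · rw [h.K_pow_pow_apply hv]
      exact S.smul_mem _ (hmem _ _)
    · rw [h.E_pow_pow_apply hp hp' hco hα hv]
      exact S.smul_mem _ (hmem _ _)
    · rw [← Module.End.mul_apply, ← pow_succ']
      exact hmem _ _
    · rw [(h.E'_F.pow_right n).apply_apply]
      have := h.symm.E_pow_pow_apply hp' hp hco.symm hα (hv.symm.congr_weight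
        (mul_right_comm α (rootOfUnity p ^ i) (rootOfUnity p' ^ j))) n' 0
      simp only [pow_zero, Module.End.one_apply] at this ⊢
      rw [this, map_smul]
      exact S.smul_mem _ (hmem _ _)
    · rw [← (h.F_F'.pow_left n).apply_apply, ← Module.End.mul_apply F', ← pow_succ']
      exact hmem _ _
  · simpa [hbot] using hmem 0 0

variable {α : ℂ} {i j : ℕ} {v : M}

lemma F_pow_apply_eq_zero (h : IsQGAction p p' K E F E' F') (hp : 2 ≤ p) (hp' : 2 ≤ p')
    (hco : p.Coprime p') (hs : IsIrreducibleUnder {K, E, F, E', F'}) (hα : α = 1 ∨ α = -1)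
    (hv : IsHighestWeight K E E' (α * rootOfUnity p ^ i * rootOfUnity p' ^ j) v) :
    (F ^ (i + 1)) v = 0 := by
  by_contra hne
  have hw : IsHighestWeight K E E' _ ((F ^ (i + 1)) v) :=
    { ne_zero := hne
      K_apply := apply_pow_of_mul_eq_smul h.K_F hv.K_apply (i + 1)
      E_apply := by
        have := h.E_pow_pow_apply hp hp' hco hα hv (i + 1) 0
        simpa [qintP_zero] using this
      E'_apply := by rw [(h.E'_F.pow_right _).apply_apply, hv.E'_apply, map_zero] }
  have htop : LinearMap.range F = ⊤ := by
    rw [eq_top_iff, ← h.span_eq_top hp hp' hco hs hw, Submodule.span_le]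
    rintro _ ⟨⟨n, n'⟩, rfl⟩
    refine ⟨(F ^ n) ((F' ^ n') ((F ^ i) v)), ?_⟩
    dsimp only
    rw [pow_succ', Module.End.mul_apply, ← (h.F_F'.pow_right n').apply_apply,
      ((Commute.refl F).pow_right n).apply_apply]
  have hsurj : Function.Surjective (F ^ p) := by
    rw [Module.End.coe_pow]
    exact (LinearMap.range_eq_top.mp htop).iterate p
  obtain ⟨u, hu⟩ := hsurj v
  exact hv.ne_zero (by rw [← hu, h.F_pow, LinearMap.zero_apply])

lemma F_pow_apply_ne_zero (h : IsQGAction p p' K E F E' F') (hp : 2 ≤ p) (hp' : 2 ≤ p')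
    (hco : p.Coprime p') (hα : α = 1 ∨ α = -1) (hi : i < p)
    (hv : IsHighestWeight K E E' (α * rootOfUnity p ^ i * rootOfUnity p' ^ j) v) {n n' : ℕ}
    (hn' : (F' ^ n') v ≠ 0) (hn : n ≤ i) : (F ^ n) ((F' ^ n') v) ≠ 0 := by
  induction n with
  | zero => simpa using hn'
  | succ n ih =>
    intro h0
    have hE := h.E_pow_pow_apply hp hp' hco hα hv (n + 1) n'
    rw [h0, map_zero, eq_comm, Nat.add_sub_cancel, smul_eq_zero] at hE
    refine hE.elim (fun hc => ?_) (ih (by omega))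
    have hα0 : α ≠ 0 := by rcases hα with rfl | rfl <;> norm_num
    have h1 : qintP p p' (n + 1 : ℕ) ≠ 0 := qintP_ne_zero hp hco (by omega) (by omega)
    have h2 : qintP p p' (i - n : ℕ) ≠ 0 := qintP_ne_zero hp hco (by omega) (by omega)
    rw [show (i + 1 - (n + 1 : ℕ) : ℤ) = (i - n : ℕ) by omega] at hc
    simp_all

/-- The vectors `F^n F'^n' v` form a basis. -/
def basis (h : IsQGAction p p' K E F E' F') (hp : 2 ≤ p) (hp' : 2 ≤ p')
    (hco : p.Coprime p') (hs : IsIrreducibleUnder {K, E, F, E', F'}) (hα : α = 1 ∨ α = -1)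
    (hi : i < p) (hj : j < p')
    (hv : IsHighestWeight K E E' (α * rootOfUnity p ^ i * rootOfUnity p' ^ j) v) :
    Module.Basis (Fin (i + 1) × Fin (j + 1)) ℂ M :=
  Module.Basis.mk (v := fun n => (F ^ (n.1 : ℕ)) ((F' ^ (n.2 : ℕ)) v))
    (by
      have hv' := hv.symm.congr_weight
        (mul_right_comm α (rootOfUnity p ^ i) (rootOfUnity p' ^ j))
      refine Module.End.eigenvectors_linearIndependent' K _ ?_ _ fun n =>
        ⟨Module.End.mem_eigenspace_iff.mpr (h.K_pow_pow_apply hv n.1 n.2), ?_⟩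
      · rintro ⟨m, m'⟩ ⟨n, n'⟩ hmn
        have hl : α * rootOfUnity p ^ i * rootOfUnity p' ^ j ≠ 0 := by
          have := rootOfUnity_ne_zero p
          have := rootOfUnity_ne_zero p'
          rcases hα with rfl | rfl <;> simp_all
        simp only [mul_assoc _ (_ ^ (_ : ℕ)) (_ ^ (_ : ℕ))] at hmn
        have := weight_injective hp hp' hco (m := m) (n := n) (m' := m') (n' := n')
          (by omega) (by omega) (by omega) (by omega)
          (mul_left_cancel₀ hl (by linear_combination hmn))
        ext <;> simp [this.1, this.2]
      · refine h.F_pow_apply_ne_zero hp hp' hco hα hi hv ?_ (by omega)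
        have := h.symm.F_pow_apply_ne_zero hp' hp hco.symm hα hj hv' (n := n.2) (n' := 0)
          (by simpa using hv.ne_zero) (by omega)
        simpa using this)
    (by
      have hv' := hv.symm.congr_weight
        (mul_right_comm α (rootOfUnity p ^ i) (rootOfUnity p' ^ j))
      rw [← h.span_eq_top hp hp' hco hs hv, Submodule.span_le]
      rintro _ ⟨⟨n, n'⟩, rfl⟩
      by_cases hn : n < i + 1
      · by_cases hn' : n' < j + 1
        · exact Submodule.subset_span ⟨(⟨n, hn⟩, ⟨n', hn'⟩), rfl⟩
        · have h0 := h.symm.F_pow_apply_eq_zero hp' hp hco.symm hs.symm hα hv'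
          simp [Module.End.pow_map_zero_of_le (not_lt.mp hn') h0]
      · have h0 := h.F_pow_apply_eq_zero hp hp' hco hs hα hv
        simp [(h.F_F'.pow_pow n n').apply_apply,
          Module.End.pow_map_zero_of_le (not_lt.mp hn) h0])

lemma basis_apply (h : IsQGAction p p' K E F E' F') (hp : 2 ≤ p) (hp' : 2 ≤ p')
    (hco : p.Coprime p') (hs : IsIrreducibleUnder {K, E, F, E', F'}) (hα : α = 1 ∨ α = -1)
    (hi : i < p) (hj : j < p')
    (hv : IsHighestWeight K E E' (α * rootOfUnity p ^ i * rootOfUnity p' ^ j) v)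
    (n : Fin (i + 1) × Fin (j + 1)) :
    h.basis hp hp' hco hs hα hi hj hv n = (F ^ (n.1 : ℕ)) ((F' ^ (n.2 : ℕ)) v) := by
  simp [basis]

end IsQGAction
end Operators

section StandardModules

variable {r r' : ℕ}

lemma qintM_eq_qintP (pp pm : ℕ) : qintM pp pm = qintP pm pp := rfl

lemma Kop_single (pp pm : ℕ) (α : ℂ) (n : Fin r × Fin r') :
    Kop pp pm α r r' (Pi.single n 1) =
      (α * rootOfUnity pp ^ ((r : ℤ) - 1 - 2 * (n.1 : ℕ)) *
        rootOfUnity pm ^ ((r' : ℤ) - 1 - 2 * (n.2 : ℕ))) • Pi.single n 1 := by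
  ext m
  by_cases h : m = n
  · subst h; simp [Kop]
  · simp [Kop, h]

lemma EopP_single (pp pm : ℕ) (α : ℂ) (n : Fin r × Fin r') :
    EopP pp pm α r r' (Pi.single n 1) =
      (α ^ pm * (-1) ^ (r' - 1) * (qintP pp pm (n.1 : ℕ) * qintP pp pm (r - (n.1 : ℕ)))) •
        Pi.single (⟨n.1 - 1, by omega⟩, n.2) 1 := by
  obtain ⟨⟨n, hn⟩, n'⟩ := n
  ext ⟨⟨m, hm⟩, m'⟩
  rcases n with _ | n
  · simp [EopP, qintP_zero, Pi.single_apply]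
  · by_cases h : m = n
    · subst h
      simp [EopP, Pi.single_apply, hn]
    · simp [EopP, h]

lemma EopM_single (pp pm : ℕ) (α : ℂ) (n : Fin r × Fin r') :
    EopM pp pm α r r' (Pi.single n 1) =
      (α ^ pp * (-1) ^ (r - 1) * (qintM pp pm (n.2 : ℕ) * qintM pp pm (r' - (n.2 : ℕ)))) •
        Pi.single (n.1, ⟨n.2 - 1, by omega⟩) 1 := by
  obtain ⟨n', ⟨n, hn⟩⟩ := n
  ext ⟨m', ⟨m, hm⟩⟩
  rcases n with _ | n
  · simp [EopM, qintM_eq_qintP, qintP_zero, Pi.single_apply]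
  · by_cases h : m = n
    · subst h
      simp [EopM, Pi.single_apply, hn]
    · simp [EopM, h]

lemma FopP_single (n : Fin r × Fin r') :
    FopP r r' (Pi.single n 1) =
      if h : n.1 + 1 < r then Pi.single (⟨n.1 + 1, h⟩, n.2) 1 else 0 := by
  obtain ⟨⟨n, hn⟩, n'⟩ := n
  ext ⟨⟨m, hm⟩, m'⟩
  rcases m with _ | m
  · simp only [FopP]
    split_ifs <;> simp
  · by_cases h : m = n
    · subst h
      simp [FopP, Pi.single_apply, hm]
    · simp only [FopP]
      split_ifs <;> simp [h]

lemma FopM_single (n : Fin r × Fin r') :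
    FopM r r' (Pi.single n 1) =
      if h : n.2 + 1 < r' then Pi.single (n.1, ⟨n.2 + 1, h⟩) 1 else 0 := by
  obtain ⟨n', ⟨n, hn⟩⟩ := n
  ext ⟨m', ⟨m, hm⟩⟩
  rcases m with _ | m
  · simp only [FopM]
    split_ifs <;> simp
  · by_cases h : m = n
    · subst h
      simp [FopM, Pi.single_apply, hm]
    · simp only [FopM]
      split_ifs <;> simp [h]

lemma FopP_pow_apply (k : ℕ) (f : Vrep r r') (n : Fin r × Fin r') :
    (FopP r r' ^ k) f n = if k ≤ n.1 then f (⟨n.1 - k, by omega⟩, n.2) else 0 := by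
  induction k generalizing f with
  | zero => simp
  | succ k ih =>
    rw [pow_succ, Module.End.mul_apply, ih]
    simp only [FopP, LinearMap.coe_mk, AddHom.coe_mk, Nat.sub_sub]
    split_ifs <;> first | rfl | omega

lemma FopM_pow_apply (k : ℕ) (f : Vrep r r') (n : Fin r × Fin r') :
    (FopM r r' ^ k) f n = if k ≤ n.2 then f (n.1, ⟨n.2 - k, by omega⟩) else 0 := by
  induction k generalizing f with
  | zero => simp
  | succ k ih =>
    rw [pow_succ, Module.End.mul_apply, ih]
    simp only [FopM, LinearMap.coe_mk, AddHom.coe_mk, Nat.sub_sub]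
    split_ifs <;> first | rfl | omega

lemma FopP_pow_mul_FopM_pow_ne_zero {k k' : ℕ} (hk : k < r) (hk' : k' < r') :
    FopP r r' ^ k * FopM r r' ^ k' ≠ 0 := by
  intro h
  have := congrFun (LinearMap.congr_fun h fun _ => 1) (⟨k, hk⟩, ⟨k', hk'⟩)
  simp [FopP_pow_apply, FopM_pow_apply] at this

lemma FopP_pow_eq_zero_iff (hr' : 0 < r') {k : ℕ} : FopP r r' ^ k = 0 ↔ r ≤ k := by
  refine ⟨fun h => ?_, fun h => ?_⟩
  · by_contra! hk
    exact FopP_pow_mul_FopM_pow_ne_zero hk hr' (by simp [h])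
  · refine LinearMap.ext fun f => funext fun n => ?_
    rw [FopP_pow_apply, if_neg (by omega)]
    rfl

lemma FopM_pow_eq_zero_iff (hr : 0 < r) {k : ℕ} : FopM r r' ^ k = 0 ↔ r' ≤ k := by
  refine ⟨fun h => ?_, fun h => ?_⟩
  · by_contra! hk
    exact FopP_pow_mul_FopM_pow_ne_zero hr hk (by simp [h])
  · refine LinearMap.ext fun f => funext fun n => ?_
    rw [FopM_pow_apply, if_neg (by omega)]
    rfl

lemma Kop_mul_FopP_pow_mul_FopM_pow (pp pm : ℕ) (α : ℂ) :
    Kop pp pm α r r' * (FopP r r' ^ (r - 1) * FopM r r' ^ (r' - 1)) =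
      (α * (rootOfUnity pp ^ (1 - r : ℤ) * rootOfUnity pm ^ (1 - r' : ℤ))) •
        (FopP r r' ^ (r - 1) * FopM r r' ^ (r' - 1)) := by
  refine LinearMap.ext fun f => funext fun n => ?_
  simp only [Module.End.mul_apply, LinearMap.smul_apply, Pi.smul_apply, FopP_pow_apply,
    FopM_pow_apply, Kop, LinearMap.coe_mk, AddHom.coe_mk, smul_eq_mul]
  split_ifs with h h'
  · rw [show (r : ℤ) - 1 - 2 * (n.1 : ℕ) = 1 - r by omega,
      show (r' : ℤ) - 1 - 2 * (n.2 : ℕ) = 1 - r' by omega, mul_assoc α]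
  all_goals simp

end StandardModules

section Representations

variable {pp pm : ℕ} {M : Type*} [AddCommGroup M] [Module ℂ M]

lemma isQGAction_gen (ρ : QG pp pm →ₐ[ℂ] Module.End ℂ M) :
    IsQGAction pp pm (ρ (gen pp pm K)) (ρ (gen pp pm Ep)) (ρ (gen pp pm Fp))
      (ρ (gen pp pm Em)) (ρ (gen pp pm Fm)) := by
  have key {x y} (h : QGRel pp pm x y) :
      ρ (RingQuot.mkAlgHom ℂ _ x) = ρ (RingQuot.mkAlgHom ℂ _ y) :=
    congrArg ρ (RingQuot.mkAlgHom_rel ℂ h)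
  have key_smul {x y c} (h : QGRel pp pm x (algebraMap ℂ _ c * y)) :
      ρ (RingQuot.mkAlgHom ℂ _ x) = c • ρ (RingQuot.mkAlgHom ℂ _ y) := by
    rw [key h, ← Algebra.smul_def, map_smul, map_smul]
  simp only [gen]
  constructor
  · simpa using key .EpNil
  · simpa using key .FpNil
  · simpa using key .EmNil
  · simpa using key .FmNil
  · simpa using key .KOrd
  · simpa using key_smul .KEp
  · simpa using key_smul .KFp
  · simpa using key_smul .KEm
  · simpa using key_smul .KFm
  · simpa [commute_iff_eq] using key .EpEm
  · simpa [commute_iff_eq] using key .FpFm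
  · simpa [commute_iff_eq] using key .EpFm
  · simpa [commute_iff_eq] using key .EmFp
  · simpa using key_smul .EpFp
  · simpa using key_smul .EmFm

lemma mem_of_forall_gen_mem {ρ : QG pp pm →ₐ[ℂ] Module.End ℂ M} {U : Submodule ℂ M}
    (h : ∀ x, U ≤ U.comap (ρ (gen pp pm x))) (a : QG pp pm) : U ≤ U.comap (ρ a) := by
  obtain ⟨a, rfl⟩ := RingQuot.mkAlgHom_surjective ℂ (QGRel pp pm) a
  induction a using FreeAlgebra.induction with
  | grade0 r =>
    intro x hx
    simpa [Algebra.algebraMap_eq_smul_one] using U.smul_mem r hx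
  | grade1 x => exact h x
  | mul a b ha hb =>
    intro x hx
    simpa using ha (hb hx)
  | add a b ha hb =>
    intro x hx
    simpa using U.add_mem (ha hx) (hb hx)

lemma isIrreducibleUnder_gen {ρ : QG pp pm →ₐ[ℂ] Module.End ℂ M}
    (hsimple : ∀ U : Submodule ℂ M, (∀ (a : QG pp pm), ∀ x ∈ U, ρ a x ∈ U) → U = ⊥ ∨ U = ⊤) :
    IsIrreducibleUnder {ρ (gen pp pm K), ρ (gen pp pm Ep), ρ (gen pp pm Fp),
      ρ (gen pp pm Em), ρ (gen pp pm Fm)} :=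
  fun U hU => hsimple U fun a _ hx =>
    mem_of_forall_gen_mem (fun x => hU _ (by cases x <;> simp)) a hx

lemma conjAlgEquiv_equivFun_eq {ι : Type*} [Fintype ι] [DecidableEq ι] (b : Module.Basis ι ℂ M)
    {A : Module.End ℂ M} {T : (ι → ℂ) →ₗ[ℂ] (ι → ℂ)}
    (h : ∀ i, b.equivFun (A (b i)) = T (Pi.single i 1)) :
    b.equivFun.conjAlgEquiv ℂ A = T := by
  refine (Pi.basisFun ℂ ι).ext fun i => ?_
  simp [← h]

/-- The coordinates of a simple module with respect to the basis `F₊^n F₋^{n'} v` turn it into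
a standard module. -/
lemma isStdRep_conj (hpp : 2 ≤ pp) (hpm : 2 ≤ pm)
    (hco : Nat.Coprime pp pm) {ρ : QG pp pm →ₐ[ℂ] Module.End ℂ M}
    (hs : IsIrreducibleUnder {ρ (gen pp pm K), ρ (gen pp pm Ep), ρ (gen pp pm Fp),
      ρ (gen pp pm Em), ρ (gen pp pm Fm)}) {α : ℂ} (hα : α = 1 ∨ α = -1) {i j : ℕ}
    (hi : i < pp) (hj : j < pm) {v : M}
    (hv : IsHighestWeight (ρ (gen pp pm K)) (ρ (gen pp pm Ep)) (ρ (gen pp pm Em))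
      (α * rootOfUnity pp ^ i * rootOfUnity pm ^ j) v) :
    IsStdRep pp pm α (i + 1) (j + 1)
      ((((isQGAction_gen ρ).basis hpp hpm hco hs hα hi hj hv).equivFun.conjAlgEquiv ℂ).toAlgHom.comp
        ρ) := by
  have h := isQGAction_gen ρ
  have hb := h.basis_apply hpp hpm hco hs hα hi hj hv
  set b := h.basis hpp hpm hco hs hα hi hj hv
  have hbs (n) : b.equivFun (b n) = Pi.single n 1 := by
    ext m
    simp [Pi.single_apply, eq_comm]
  have hv' := hv.symm.congr_weight
    (mul_right_comm α (rootOfUnity pp ^ i) (rootOfUnity pm ^ j))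
  refine ⟨?_, ?_, ?_, ?_, ?_⟩ <;> refine conjAlgEquiv_equivFun_eq (A := ρ _) b fun n => ?_
  · rw [Kop_single, ← hbs, ← map_smul, hb, h.K_pow_pow_apply hv]
    congr 2
    have h0 := rootOfUnity_ne_zero pp
    have h0' := rootOfUnity_ne_zero pm
    push_cast
    rw [add_sub_cancel_right, add_sub_cancel_right, zpow_sub₀ h0, zpow_sub₀ h0', zpow_mul,
      zpow_mul]
    norm_cast
    rw [inv_pow, inv_pow]
    ring
  · rw [EopP_single, ← hbs, ← map_smul, hb, hb, h.E_pow_pow_apply hpp hpm hco hα hv]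
    simp
  · rw [EopM_single, ← hbs, ← map_smul, hb, hb, (h.F_F'.pow_pow _ _).apply_apply,
      h.symm.E_pow_pow_apply hpm hpp hco.symm hα hv', ← (h.F_F'.pow_pow _ _).apply_apply]
    simp [qintM_eq_qintP]
  · rw [FopP_single]
    split_ifs with hn
    · rw [← hbs, hb, hb, ← Module.End.mul_apply, ← pow_succ']
    · rw [hb, ← Module.End.mul_apply, ← pow_succ', show (n.1 : ℕ) + 1 = i + 1 by omega,
        (h.F_F'.pow_pow _ _).apply_apply, h.F_pow_apply_eq_zero hpp hpm hco hs hα hv]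
      simp
  · rw [FopM_single]
    split_ifs with hn
    · rw [← hbs, hb, hb, ← (h.F_F'.pow_left _).apply_apply, ← Module.End.mul_apply (ρ _),
        ← pow_succ']
    · rw [hb, ← (h.F_F'.pow_left _).apply_apply, ← Module.End.mul_apply (ρ _), ← pow_succ',
        show (n.2 : ℕ) + 1 = j + 1 by omega,
        h.symm.F_pow_apply_eq_zero hpm hpp hco.symm hs.symm hα hv']
      simp

lemma map_eq_zero_iff_of_intertwines {N : Type*} [AddCommGroup N] [Module ℂ N]
    {ρ : QG pp pm →ₐ[ℂ] Module.End ℂ M} {σ : QG pp pm →ₐ[ℂ] Module.End ℂ N} (e : M ≃ₗ[ℂ] N)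
    (h : ∀ a x, e (ρ a x) = σ a (e x)) (a : QG pp pm) : ρ a = 0 ↔ σ a = 0 := by
  constructor <;> intro ha <;> ext x
  · simpa [ha] using (h a (e.symm x)).symm
  · simpa [ha] using h a x

lemma isStdRep_unique {ρ : QG pp pm →ₐ[ℂ] Module.End ℂ M} {α β : ℂ} {r r' s s' : ℕ}
    (hr : 0 < r) (hr' : 0 < r') (hs : 0 < s) (hs' : 0 < s')
    {σ : QG pp pm →ₐ[ℂ] Module.End ℂ (Vrep r r')} {τ : QG pp pm →ₐ[ℂ] Module.End ℂ (Vrep s s')}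
    (hσ : IsStdRep pp pm α r r' σ) (hτ : IsStdRep pp pm β s s' τ)
    (e : M ≃ₗ[ℂ] Vrep r r') (he : ∀ a x, e (ρ a x) = σ a (e x))
    (f : M ≃ₗ[ℂ] Vrep s s') (hf : ∀ a x, f (ρ a x) = τ a (f x)) :
    (α, r, r') = (β, s, s') := by
  obtain ⟨hσK, -, -, hσP, hσM⟩ := hσ
  obtain ⟨hτK, -, -, hτP, hτM⟩ := hτ
  have key (a) : σ a = 0 ↔ τ a = 0 :=
    (map_eq_zero_iff_of_intertwines e he a).symm.trans (map_eq_zero_iff_of_intertwines f hf a)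
  have hrs (k : ℕ) : r ≤ k ↔ s ≤ k := by
    have := key (gen pp pm Fp ^ k)
    rwa [map_pow, map_pow, hσP, hτP, FopP_pow_eq_zero_iff hr', FopP_pow_eq_zero_iff hs'] at this
  have hrs' (k : ℕ) : r' ≤ k ↔ s' ≤ k := by
    have := key (gen pp pm Fm ^ k)
    rwa [map_pow, map_pow, hσM, hτM, FopM_pow_eq_zero_iff hr, FopM_pow_eq_zero_iff hs] at this
  obtain rfl : r = s := le_antisymm ((hrs s).mpr le_rfl) ((hrs r).mp le_rfl)
  obtain rfl : r' = s' := le_antisymm ((hrs' s').mpr le_rfl) ((hrs' r').mp le_rfl)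
  set c := rootOfUnity pp ^ (1 - r : ℤ) * rootOfUnity pm ^ (1 - r' : ℤ) with hc
  have hc0 : c ≠ 0 :=
    mul_ne_zero (zpow_ne_zero _ (rootOfUnity_ne_zero _)) (zpow_ne_zero _ (rootOfUnity_ne_zero _))
  have h := (key (gen pp pm K * (gen pp pm Fp ^ (r - 1) * gen pp pm Fm ^ (r' - 1)) -
    (α * c) • (gen pp pm Fp ^ (r - 1) * gen pp pm Fm ^ (r' - 1)))).mp (by
      simp only [map_sub, map_mul, map_pow, map_smul, hσK, hσP, hσM,
        Kop_mul_FopP_pow_mul_FopM_pow, hc, sub_self])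
  simp only [map_sub, map_mul, map_pow, map_smul, hτK, hτP, hτM,
    Kop_mul_FopP_pow_mul_FopM_pow, ← hc] at h
  have hne : FopP r r' ^ (r - 1) * FopM r r' ^ (r' - 1) ≠ 0 :=
    FopP_pow_mul_FopM_pow_ne_zero (by omega) (by omega)
  rw [mul_right_cancel₀ hc0 (smul_left_injective ℂ hne (sub_eq_zero.mp h))]

end Representations

/-- Every finite-dimensional simple `g_{p₊,p₋}`-module is isomorphic to `X^α_{r,r'}` for
exactly one triple `(α, r, r')` with `α ∈ {1,−1}`, `1 ≤ r ≤ p₊`, `1 ≤ r' ≤ p₋`. -/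
theorem simple_modules_classification (pp pm : ℕ) (hpp : 2 ≤ pp) (hpm : 2 ≤ pm)
    (hco : Nat.Coprime pp pm)
    (M : Type) [AddCommGroup M] [Module ℂ M] [FiniteDimensional ℂ M] [Nontrivial M]
    (ρ : QG pp pm →ₐ[ℂ] Module.End ℂ M)
    (hsimple : ∀ U : Submodule ℂ M, (∀ (a : QG pp pm), ∀ x ∈ U, ρ a x ∈ U) → U = ⊥ ∨ U = ⊤) :
    ∃! t : ℂ × ℕ × ℕ,
      (t.1 = 1 ∨ t.1 = -1) ∧
      1 ≤ t.2.1 ∧ t.2.1 ≤ pp ∧ 1 ≤ t.2.2 ∧ t.2.2 ≤ pm ∧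
      ∃ (σ : QG pp pm →ₐ[ℂ] Module.End ℂ (Vrep t.2.1 t.2.2))
        (e : M ≃ₗ[ℂ] Vrep t.2.1 t.2.2),
          IsStdRep pp pm t.1 t.2.1 t.2.2 σ ∧
          ∀ (a : QG pp pm) (x : M), e (ρ a x) = σ a (e x) := by
  have h := isQGAction_gen ρ
  have hs := isIrreducibleUnder_gen hsimple
  obtain ⟨l, v, hv⟩ := h.exists_isHighestWeight
  obtain ⟨i, hi, j, hj, α, hα, rfl⟩ := exists_weight hpp hpm hco (h.weight_pow hv)
  have hstd := isStdRep_conj hpp hpm hco hs hα hi hj hv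
  set e := (h.basis hpp hpm hco hs hα hi hj hv).equivFun
  have he : ∀ a x, e (ρ a x) = e.conjAlgEquiv ℂ (ρ a) (e x) := by
    intro a x
    simp [LinearEquiv.conjAlgEquiv_apply_apply]
  refine ⟨(α, i + 1, j + 1), ⟨hα, by simp, hi, by simp, hj, _, e, hstd, he⟩, ?_⟩
  rintro ⟨β, s, s'⟩ ⟨-, hs1, -, hs1', -, τ, f, hτ, hf⟩
  exact isStdRep_unique hs1 hs1' (Nat.succ_pos i) (Nat.succ_pos j) hτ hstd f hf e he
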